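/- arXiv:2505.21574 — 3 statements merged into one kernel-verified Lean document; each statement's English description precedes it below -/
import Mathlib

section
/- In the two-patch data model, for every weight matrix W and every filter index j, the alignment of the filter-j gradient with the fast-learnable feature satisfies ⟨∇_{w_j} L(W), v_e⟩ = −(3 β_e³ / N) Σ_{i=1}^{αN} l_i ⟨w_j, v_e⟩². -/
open scoped BigOperators RealInnerProductSpace

/-- The sigmoid (logistic) function. -/
noncomputable def sigmoid (z : ℝ) : ℝ := 1 / (1 + Real.exp (-z))

/-- The Fréchet derivative of the cubic activation `w ↦ ⟪w, a⟫ ^ 3`. -/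
theorem hasFDerivAt_inner_pow_three {E : Type*} [NormedAddCommGroup E] [InnerProductSpace ℝ E]
    (a w : E) :
    HasFDerivAt (fun w : E => ⟪w, a⟫ ^ 3) ((3 * ⟪w, a⟫ ^ 2) • innerSL ℝ a) w := by
  have h : HasFDerivAt (fun w : E => ⟪w, a⟫) (innerSL ℝ a) w := by
    have h' := (innerSL ℝ a).hasFDerivAt (x := w)
    refine h'.congr_of_eventuallyEq (Filter.Eventually.of_forall fun x => ?_)
    simp [real_inner_comm]
  simpa using h.pow 3

/-- The Fréchet derivative of the logistic loss `log (1 + exp (-(c * g)))` of a margin `c * g`. -/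
theorem HasFDerivAt.logistic_loss {E : Type*} [NormedAddCommGroup E] [NormedSpace ℝ E]
    {g : E → ℝ} {g' : E →L[ℝ] ℝ} {w : E} (hg : HasFDerivAt g g' w) (c : ℝ) :
    HasFDerivAt (fun w => Real.log (1 + Real.exp (-(c * g w))))
      (-(c * sigmoid (-(c * g w))) • g') w := by
  have hpos : 1 + Real.exp (-(c * g w)) ≠ 0 := by positivity
  refine (((hg.const_mul c).neg.exp.const_add 1).log hpos).congr_fderiv ?_
  ext v
  have hexp : Real.exp (c * g w) * Real.exp (-(c * g w)) = 1 := by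
    rw [← Real.exp_add]; simp
  have hpos' : 1 + Real.exp (c * g w) ≠ 0 := by positivity
  have hsig : (1 + Real.exp (-(c * g w)))⁻¹ * Real.exp (-(c * g w)) =
      sigmoid (-(c * g w)) := by
    rw [sigmoid, neg_neg]
    field_simp
    linear_combination hexp
  rw [← hsig]
  simp only [smul_apply, neg_apply, Pi.neg_apply, smul_eq_mul]
  ring

/-- If, as a function of the `j`-th coordinate alone, only the `j`-th summand varies, then the
sum has the derivative of that summand. -/
theorem HasFDerivAt.sum_update {ι E : Type*} [Fintype ι] [DecidableEq ι] [NormedAddCommGroup E]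
    [NormedSpace ℝ E] {g : E → ℝ} {g' : E →L[ℝ] ℝ} (W : ι → E) (j : ι) {w : E}
    (hg : HasFDerivAt g g' w) :
    HasFDerivAt (fun w => ∑ k, g (Function.update W j w k)) g' w := by
  have h : (fun w => ∑ k, g (Function.update W j w k)) =
      fun w => g w + ∑ k ∈ Finset.univ.erase j, g (W k) := by
    funext w
    rw [← Finset.add_sum_erase _ _ (Finset.mem_univ j), Function.update_self]
    congr 1
    refine Finset.sum_congr rfl fun k hk => ?_
    rw [Function.update_of_ne (Finset.ne_of_mem_erase hk)]
  rw [h]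
  exact hg.add_const _

/-- Alignment of the filter-`j` gradient with the fast-learnable feature:
`⟨∇_{w_j} L(W), v_e⟩ = −(3β_e³/N) Σ_{i=1}^{αN} l_i ⟨w_j, v_e⟩²`. -/
theorem gradient_fast_feature_alignment
    (d N J m : ℕ) (hd : 1 ≤ d) (hN : 1 ≤ N) (hJ : 1 ≤ J)
    (α : ℝ) (hα0 : 0 < α) (hα1 : α < 1) (hm : (m : ℝ) = α * N)
    (βd βe : ℝ) (hβd : 0 ≤ βd) (hβ : βd < βe)
    (ve vd : EuclideanSpace ℝ (Fin d)) (hve : ‖ve‖ = 1) (hvd : ‖vd‖ = 1)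
    (hvevd : ⟪ve, vd⟫ = 0)
    (y : ℕ → ℝ) (hy : ∀ i < N, y i = 1 ∨ y i = -1)
    (ξ : ℕ → EuclideanSpace ℝ (Fin d)) (hξ : ∀ i < N, ξ i ≠ 0)
    (hξorth : ∀ i < N, ∀ i' < N, i ≠ i' → ⟪ξ i, ξ i'⟫ = 0)
    (hξe : ∀ i < N, ⟪ξ i, ve⟫ = 0) (hξd : ∀ i < N, ⟪ξ i, vd⟫ = 0)
    -- the feature patch of the `i`-th data point
    (feat : ℕ → EuclideanSpace ℝ (Fin d))
    (hfeat : ∀ i < N, feat i = if i < m then (βe * y i) • ve else (βd * y i) • vd)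
    -- the two-layer cubic CNN applied to the `i`-th data point (patches `feat i` and `ξ i`)
    (f : (Fin J → EuclideanSpace ℝ (Fin d)) → ℕ → ℝ)
    (hf : ∀ W i, f W i = ∑ j : Fin J, (⟪W j, feat i⟫ ^ 3 + ⟪W j, ξ i⟫ ^ 3))
    -- the empirical logistic loss on the original dataset
    (L : (Fin J → EuclideanSpace ℝ (Fin d)) → ℝ)
    (hL : ∀ W, L W = (1 / (N : ℝ)) *
      ∑ i ∈ Finset.range N, Real.log (1 + Real.exp (-(y i * f W i))))
    (W : Fin J → EuclideanSpace ℝ (Fin d)) (j : Fin J)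
    -- the logits
    (l : ℕ → ℝ) (hl : ∀ i, l i = sigmoid (-(y i * f W i)))
    :
    ⟪gradient (fun w => L (Function.update W j w)) (W j), ve⟫
      = -(3 * βe ^ 3 / (N : ℝ)) * ∑ i ∈ Finset.range m, l i * ⟪W j, ve⟫ ^ 2 := by
  have hmN : m ≤ N := by
    have h : (m : ℝ) ≤ N := by
      rw [hm]
      exact mul_le_of_le_one_left (Nat.cast_nonneg N) hα1.le
    exact_mod_cast h
  have hderiv : ∀ i, HasFDerivAt (fun w => f (Function.update W j w) i)
      ((3 * ⟪W j, feat i⟫ ^ 2) • innerSL ℝ (feat i) + (3 * ⟪W j, ξ i⟫ ^ 2) • innerSL ℝ (ξ i))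
      (W j) := by
    intro i
    simp only [hf]
    exact ((hasFDerivAt_inner_pow_three (feat i) (W j)).add
      (hasFDerivAt_inner_pow_three (ξ i) (W j))).sum_update W j
  have hLderiv := (HasFDerivAt.fun_sum (u := Finset.range N) fun i _ =>
    (hderiv i).logistic_loss (y i)).const_mul (1 / (N : ℝ))
  simp only [← hL, Function.update_eq_self, ← hl] at hLderiv
  rw [gradient, InnerProductSpace.toDual_symm_apply, hLderiv.fderiv]
  simp only [smul_apply, sum_apply,
    add_apply, innerSL_apply_apply, smul_eq_mul]
  rw [← Finset.sum_subset (Finset.range_subset_range.mpr hmN), Finset.mul_sum, Finset.mul_sum]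
  · refine Finset.sum_congr rfl fun i hi => ?_
    have him := Finset.mem_range.mp hi
    have hiN := him.trans_le hmN
    have hy4 : y i ^ 4 = 1 := by rcases hy i hiN with h | h <;> norm_num [h]
    rw [hξe i hiN, hfeat i hiN, if_pos him, real_inner_smul_left, real_inner_smul_right,
      real_inner_self_eq_norm_sq, hve]
    linear_combination (-(3 * βe ^ 3 / (N : ℝ)) * (l i * ⟪W j, ve⟫ ^ 2)) * hy4
  · intro i hi him
    have hiN := Finset.mem_range.mp hi
    rw [hξe i hiN, hfeat i hiN, if_neg (by simpa using him), real_inner_smul_left,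
      real_inner_comm ve vd, hvevd]
    ring
end

section
/- In the two-patch data model with generated dataset D_G of factor k, for every weight matrix W, every filter index j, and every noise vector φ_i of D_G (φ_i = ξ_i for 1 ≤ i ≤ N and φ_i = γ_i for N < i ≤ N_new), the gradient alignment satisfies ⟨∇^G_{w_j} L(W), φ_i⟩ = −(3/N_new) · l_i · y_i · ⟨w_j, φ_i⟩² · ‖φ_i‖²; in particular every noise of D_G, original or synthetic, is learned with the same uniform 3/N_new factor. -/
open scoped BigOperators RealInnerProductSpace

theorem hasDerivAt_log_one_add_exp_neg (z : ℝ) :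
    HasDerivAt (fun z => Real.log (1 + Real.exp (-z))) (-sigmoid (-z)) z := by
  have hpos : 0 < 1 + Real.exp (-z) := by positivity
  have h := ((hasDerivAt_neg z).exp.const_add 1).log hpos.ne'
  refine h.congr_deriv ?_
  have hexp : Real.exp (-z) * Real.exp z = 1 := by rw [← Real.exp_add]; simp
  have hpos' : 0 < 1 + Real.exp z := by positivity
  rw [sigmoid, neg_neg, mul_neg_one, neg_div, neg_inj, div_eq_div_iff hpos.ne' hpos'.ne']
  linear_combination hexp

/-- The derivative in one filter of the output of a cubic network on a two-patch input. -/
theorem hasFDerivAt_sum_update_inner_pow_three {ι E : Type*} [Fintype ι] [DecidableEq ι]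
    [NormedAddCommGroup E] [InnerProductSpace ℝ E] (W : ι → E) (j : ι) (a b : E) :
    HasFDerivAt
      (fun w => ∑ j', (⟪Function.update W j w j', a⟫ ^ 3 + ⟪Function.update W j w j', b⟫ ^ 3))
      ((3 * ⟪W j, a⟫ ^ 2) • innerSL ℝ a + (3 * ⟪W j, b⟫ ^ 2) • innerSL ℝ b) (W j) := by
  have h := ((hasFDerivAt_inner_pow_three a (W j)).add
    (hasFDerivAt_inner_pow_three b (W j))).add_const
      (∑ j' ∈ Finset.univ.erase j, (⟪W j', a⟫ ^ 3 + ⟪W j', b⟫ ^ 3))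
  refine h.congr_of_eventuallyEq (Filter.Eventually.of_forall fun w => ?_)
  simp only [Pi.add_apply]
  rw [← Finset.add_sum_erase _ _ (Finset.mem_univ j), Function.update_self]
  congr 1
  refine Finset.sum_congr rfl fun j' hj' => ?_
  rw [Function.update_of_ne (Finset.ne_of_mem_erase hj')]

/-- For the generated dataset `D_G` of factor `k`, every noise vector `φ_i`
(`φ_i = ξ_i` for `i ≤ N` and `φ_i = γ_i` for `N < i ≤ N_new`) satisfies
`⟨∇^G_{w_j} L(W), φ_i⟩ = −(3/N_new)·l_i·y_i·⟨w_j,φ_i⟩²·‖φ_i‖²`: every noise of `D_G`,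
original or synthetic, is learned with the same uniform `3/N_new` factor. -/
theorem generated_gradient_noise_alignment
    (d N J m : ℕ) (hd : 1 ≤ d) (hN : 1 ≤ N) (hJ : 1 ≤ J)
    (α : ℝ) (hα0 : 0 < α) (hα1 : α < 1) (hm : (m : ℝ) = α * N)
    (βd βe : ℝ) (hβd : 0 ≤ βd) (hβ : βd < βe)
    (k : ℕ) (hk : 2 ≤ k) (Nnew : ℕ)
    (hNnew : (Nnew : ℝ) = α * N + k * (1 - α) * N)
    (ve vd : EuclideanSpace ℝ (Fin d)) (hve : ‖ve‖ = 1) (hvd : ‖vd‖ = 1)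
    (hvevd : ⟪ve, vd⟫ = 0)
    (y : ℕ → ℝ) (hy : ∀ i < Nnew, y i = 1 ∨ y i = -1)
    -- the noise patches of `D_G`: original noises `ξ i` for `i ≤ N`, synthetic noises
    -- `γ i` for `N < i ≤ N_new`
    (ξ γ φ : ℕ → EuclideanSpace ℝ (Fin d))
    (hφ : ∀ i, φ i = if i < N then ξ i else γ i)
    (hφ0 : ∀ i < Nnew, φ i ≠ 0)
    (hφorth : ∀ i < Nnew, ∀ i' < Nnew, i ≠ i' → ⟪φ i, φ i'⟫ = 0)
    (hφe : ∀ i < Nnew, ⟪φ i, ve⟫ = 0) (hφd : ∀ i < Nnew, ⟪φ i, vd⟫ = 0)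
    -- the feature patch of the `i`-th point of `D_G` (the synthetic points carry the
    -- slow-learnable feature `β_d·y_i·v_d`)
    (feat : ℕ → EuclideanSpace ℝ (Fin d))
    (hfeat : ∀ i < Nnew, feat i = if i < m then (βe * y i) • ve else (βd * y i) • vd)
    -- the two-layer cubic CNN applied to the `i`-th point of `D_G`
    (f : (Fin J → EuclideanSpace ℝ (Fin d)) → ℕ → ℝ)
    (hf : ∀ W i, f W i = ∑ j : Fin J, (⟪W j, feat i⟫ ^ 3 + ⟪W j, φ i⟫ ^ 3))
    -- the empirical logistic loss on the generated dataset `D_G`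
    (LG : (Fin J → EuclideanSpace ℝ (Fin d)) → ℝ)
    (hLG : ∀ W, LG W = (1 / (Nnew : ℝ)) *
      ∑ i ∈ Finset.range Nnew, Real.log (1 + Real.exp (-(y i * f W i))))
    (W : Fin J → EuclideanSpace ℝ (Fin d)) (j : Fin J)
    -- the logits
    (l : ℕ → ℝ) (hl : ∀ i, l i = sigmoid (-(y i * f W i)))
    :
    ∀ i < Nnew,
      ⟪gradient (fun w => LG (Function.update W j w)) (W j), φ i⟫
        = -(3 / (Nnew : ℝ)) * l i * y i * ⟪W j, φ i⟫ ^ 2 * ‖φ i‖ ^ 2 := by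
  intro i hi
  have hterm : ∀ n, HasFDerivAt
      (fun w => Real.log (1 + Real.exp (-(y n * f (Function.update W j w) n))))
      ((-l n) • y n • ((3 * ⟪W j, feat n⟫ ^ 2) • innerSL ℝ (feat n) +
        (3 * ⟪W j, φ n⟫ ^ 2) • innerSL ℝ (φ n))) (W j) := by
    intro n
    have h := (hasFDerivAt_sum_update_inner_pow_three W j (feat n) (φ n)).const_mul (y n)
    simp only [← hf] at h
    have hlog := hasDerivAt_log_one_add_exp_neg (y n * f (Function.update W j (W j)) n)
    rw [Function.update_eq_self, ← hl] at hlog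
    refine HasDerivAt.comp_hasFDerivAt (h₂ := fun z => Real.log (1 + Real.exp (-z)))
      (W j) ?_ h
    rwa [Function.update_eq_self]
  have hsum := (HasFDerivAt.fun_sum (u := Finset.range Nnew) fun n _ => hterm n).const_mul
    (1 / (Nnew : ℝ))
  simp only [← hLG] at hsum
  have hfeat_orth : ∀ n < Nnew, ⟪feat n, φ i⟫ = 0 := by
    intro n hn
    rw [hfeat n hn, real_inner_comm]
    split_ifs <;> simp [inner_smul_right, hφe i hi, hφd i hi]
  rw [inner_gradient_left, hsum.fderiv]
  simp only [smul_apply, sum_apply, add_apply, innerSL_apply_apply, smul_eq_mul]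
  rw [Finset.sum_eq_single_of_mem i (Finset.mem_range.mpr hi)]
  · rw [hfeat_orth i hi, real_inner_self_eq_norm_sq]
    ring
  · intro n hn hne
    have hn' := Finset.mem_range.mp hn
    rw [hfeat_orth n hn', hφorth n hn' i hi hne]
    ring
end

section
/- In the two-patch data model with augmented datasets D_U and D_G of factor k, suppose all slow-feature logits share a common value ℓ ∈ (0,1) (i.e., l_i = ℓ for all points of D_U and of D_G whose feature patch is β_d·y_i·v_d). Then for every weight matrix W and filter index j, the slow-feature gradient alignments of upsampling and generation coincide: ⟨∇^U_{w_j} L(W), v_d⟩ = ⟨∇^G_{w_j} L(W), v_d⟩ = −(3 k (1−α) N β_d³ ℓ / N_new) · ⟨w_j, v_d⟩². -/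
open scoped BigOperators RealInnerProductSpace

/-- Pairing the gradient with a vector evaluates the Fréchet derivative at that vector. -/
theorem inner_gradient_eq_of_hasFDerivAt {E : Type*} [NormedAddCommGroup E]
    [InnerProductSpace ℝ E] [CompleteSpace E] {g : E → ℝ} {G : E →L[ℝ] ℝ} {w : E}
    (h : HasFDerivAt g G w) (v : E) : ⟪gradient g w, v⟫ = G v := by
  rw [gradient, h.fderiv, InnerProductSpace.toDual_symm_apply]

/-- The derivative of the logistic loss of a cubic neuron acting on two patches `a` and `b`, in a
direction `v` orthogonal to the patch `b`. -/
theorem exists_hasFDerivAt_logistic_cubic {E : Type*} [NormedAddCommGroup E]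
    [InnerProductSpace ℝ E] (y c : ℝ) (a b v w : E) (hb : ⟪b, v⟫ = 0) :
    ∃ G : E →L[ℝ] ℝ,
      HasFDerivAt
        (fun u => Real.log (1 + Real.exp (-(y * (c + (⟪u, a⟫ ^ 3 + ⟪u, b⟫ ^ 3)))))) G w ∧
      G v = -(3 * y * sigmoid (-(y * (c + (⟪w, a⟫ ^ 3 + ⟪w, b⟫ ^ 3)))) *
        ⟪w, a⟫ ^ 2 * ⟪a, v⟫) := by
  have hinner (x : E) : HasFDerivAt (fun u : E => ⟪u, x⟫) (innerSL ℝ x) w := by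
    rw [show (fun u : E => ⟪u, x⟫) = innerSL ℝ x from funext fun u => real_inner_comm x u]
    exact (innerSL ℝ x).hasFDerivAt
  have hpos := Real.exp_pos (-(y * (c + (⟪w, a⟫ ^ 3 + ⟪w, b⟫ ^ 3))))
  refine ⟨_, ((((((hinner a).pow 3).fun_add ((hinner b).pow 3)).const_add c).const_mul
    y).fun_neg.exp.const_add 1).log (by positivity), ?_⟩
  simp only [sigmoid, smul_apply, add_apply, neg_apply, innerSL_apply_apply, hb, neg_neg,
    smul_eq_mul, nsmul_eq_mul, Nat.cast_ofNat]
  rw [Real.exp_neg] at hpos ⊢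
  have hexp := Real.exp_pos (y * (c + (⟪w, a⟫ ^ 3 + ⟪w, b⟫ ^ 3)))
  generalize Real.exp (y * (c + (⟪w, a⟫ ^ 3 + ⟪w, b⟫ ^ 3))) = e at *
  have h1 : 1 + e ≠ 0 := by positivity
  have h2 : 1 + e⁻¹ ≠ 0 := by positivity
  field_simp
  ring

/-- If all slow-feature logits of `D_U` and `D_G` share a common value
`ℓ ∈ (0,1)`, then the slow-feature gradient alignments of upsampling and generation coincide:
`⟨∇^U_{w_j} L(W), v_d⟩ = ⟨∇^G_{w_j} L(W), v_d⟩ = −(3k(1−α)Nβ_d³ℓ/N_new)·⟨w_j, v_d⟩²`. -/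
theorem upsampling_vs_generation_slow_feature_alignment
    (d N J m : ℕ) (hd : 1 ≤ d) (hN : 1 ≤ N) (hJ : 1 ≤ J)
    (α : ℝ) (hα0 : 0 < α) (hα1 : α < 1) (hm : (m : ℝ) = α * N)
    (βd βe : ℝ) (hβd : 0 ≤ βd) (hβ : βd < βe)
    (k : ℕ) (hk : 2 ≤ k) (Nnew : ℕ)
    (hNnew : (Nnew : ℝ) = α * N + k * (1 - α) * N)
    (ve vd : EuclideanSpace ℝ (Fin d)) (hve : ‖ve‖ = 1) (hvd : ‖vd‖ = 1)
    (hvevd : ⟪ve, vd⟫ = 0)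
    (y : ℕ → ℝ) (hy : ∀ i < Nnew, y i = 1 ∨ y i = -1)
    -- the noise patches of `D_G`: original noises `ξ i` for `i ≤ N`, synthetic noises
    -- `γ i` for `N < i ≤ N_new`
    (ξ γ φ : ℕ → EuclideanSpace ℝ (Fin d))
    (hφ : ∀ i, φ i = if i < N then ξ i else γ i)
    (hφ0 : ∀ i < Nnew, φ i ≠ 0)
    (hφorth : ∀ i < Nnew, ∀ i' < Nnew, i ≠ i' → ⟪φ i, φ i'⟫ = 0)
    (hφe : ∀ i < Nnew, ⟪φ i, ve⟫ = 0) (hφd : ∀ i < Nnew, ⟪φ i, vd⟫ = 0)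
    -- the feature patch of the `i`-th point of `D_G` (the synthetic points carry the
    -- slow-learnable feature `β_d·y_i·v_d`)
    (feat : ℕ → EuclideanSpace ℝ (Fin d))
    (hfeat : ∀ i < Nnew, feat i = if i < m then (βe * y i) • ve else (βd * y i) • vd)
    -- the two-layer cubic CNN applied to the `i`-th point of `D_G`
    (f : (Fin J → EuclideanSpace ℝ (Fin d)) → ℕ → ℝ)
    (hf : ∀ W i, f W i = ∑ j : Fin J, (⟪W j, feat i⟫ ^ 3 + ⟪W j, φ i⟫ ^ 3))
    -- the empirical logistic loss on the generated dataset `D_G`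
    (LG : (Fin J → EuclideanSpace ℝ (Fin d)) → ℝ)
    (hLG : ∀ W, LG W = (1 / (Nnew : ℝ)) *
      ∑ i ∈ Finset.range Nnew, Real.log (1 + Real.exp (-(y i * f W i))))
    -- the empirical logistic loss on the upsampled dataset `D_U` (each slow-learnable
    -- original point, i.e. each `i` with `αN < i ≤ N`, appears exactly `k` times)
    (LU : (Fin J → EuclideanSpace ℝ (Fin d)) → ℝ)
    (hLU : ∀ W, LU W = (1 / (Nnew : ℝ)) *
      ((∑ i ∈ Finset.range m, Real.log (1 + Real.exp (-(y i * f W i)))) +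
        k * ∑ i ∈ Finset.Ico m N, Real.log (1 + Real.exp (-(y i * f W i)))))
    (W : Fin J → EuclideanSpace ℝ (Fin d)) (j : Fin J)
    -- the logits
    (l : ℕ → ℝ) (hl : ∀ i, l i = sigmoid (-(y i * f W i)))
    -- all slow-feature logits share the common value `ℓ ∈ (0,1)`
    (ℓ : ℝ) (hℓ : ℓ ∈ Set.Ioo (0 : ℝ) 1)
    (hslow : ∀ i, m ≤ i → i < Nnew → l i = ℓ)
    :
    ⟪gradient (fun w => LU (Function.update W j w)) (W j), vd⟫
      = -(3 * k * (1 - α) * N * βd ^ 3 * ℓ / (Nnew : ℝ)) * ⟪W j, vd⟫ ^ 2 ∧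
    ⟪gradient (fun w => LG (Function.update W j w)) (W j), vd⟫
      = -(3 * k * (1 - α) * N * βd ^ 3 * ℓ / (Nnew : ℝ)) * ⟪W j, vd⟫ ^ 2 := by
  have hmN : m ≤ N := by
    have : (m : ℝ) ≤ N := by
      rw [hm]; exact mul_le_of_le_one_left (Nat.cast_nonneg N) hα1.le
    exact_mod_cast this
  have hk' : (2 : ℝ) ≤ k := by exact_mod_cast hk
  have hsub : (N : ℝ) - m = (1 - α) * N := by rw [hm]; ring
  have hcard : (Nnew : ℝ) - m = k * (1 - α) * N := by rw [hm, hNnew]; ring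
  have hNle : N ≤ Nnew := by
    have hnn : 0 ≤ (1 - α) * N := mul_nonneg (by linarith) (Nat.cast_nonneg N)
    have : (N : ℝ) ≤ Nnew := by nlinarith
    exact_mod_cast this
  have hsplit (i : ℕ) (w : EuclideanSpace ℝ (Fin d)) :
      f (Function.update W j w) i =
        ∑ j' ∈ Finset.univ.erase j, (⟪W j', feat i⟫ ^ 3 + ⟪W j', φ i⟫ ^ 3) +
          (⟪w, feat i⟫ ^ 3 + ⟪w, φ i⟫ ^ 3) := by
    rw [hf, ← Finset.sum_erase_add _ _ (Finset.mem_univ j), Function.update_self]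
    congr 1
    refine Finset.sum_congr rfl fun j' hj' => ?_
    rw [Function.update_of_ne (Finset.ne_of_mem_erase hj')]
  have hpoint : ∀ i, ∃ G : EuclideanSpace ℝ (Fin d) →L[ℝ] ℝ, i < Nnew →
      HasFDerivAt (fun w => Real.log (1 + Real.exp (-(y i * f (Function.update W j w) i)))) G
        (W j) ∧
      G vd = if i < m then 0 else -(3 * βd ^ 3 * ℓ * ⟪W j, vd⟫ ^ 2) := by
    intro i
    by_cases hi : i < Nnew
    swap
    · exact ⟨0, fun h => absurd h hi⟩
    obtain ⟨G, hG, hGv⟩ := exists_hasFDerivAt_logistic_cubic (y i)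
      (∑ j' ∈ Finset.univ.erase j, (⟪W j', feat i⟫ ^ 3 + ⟪W j', φ i⟫ ^ 3))
      (feat i) (φ i) vd (W j) (hφd i hi)
    refine ⟨G, fun _ => ⟨by simpa only [hsplit] using hG, ?_⟩⟩
    rw [hGv, ← hsplit, Function.update_eq_self, ← hl, hfeat i hi]
    split_ifs with him
    · simp [real_inner_smul_left, hvevd]
    · rw [hslow i (not_lt.mp him) hi]
      simp only [real_inner_smul_left, real_inner_smul_right, real_inner_self_eq_norm_sq, hvd]
      rcases hy i hi with h | h <;> rw [h] <;> ring
  choose G hG using hpoint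
  have hfast : ∑ i ∈ Finset.range m, G i vd = 0 :=
    Finset.sum_eq_zero fun i hi => by
      have him := Finset.mem_range.mp hi
      rw [(hG i (by omega)).2, if_pos him]
  have hslowsum (n : ℕ) (hmn : m ≤ n) (hn : n ≤ Nnew) :
      ∑ i ∈ Finset.Ico m n, G i vd = (n - m) * -(3 * βd ^ 3 * ℓ * ⟪W j, vd⟫ ^ 2) := by
    rw [Finset.sum_congr rfl fun i hi => ?_, Finset.sum_const, Nat.card_Ico, nsmul_eq_mul,
      Nat.cast_sub hmn]
    have hi := Finset.mem_Ico.mp hi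
    rw [(hG i (by omega)).2, if_neg (by omega)]
  have hsum (s : Finset ℕ) (hs : ∀ i ∈ s, i < Nnew) := HasFDerivAt.fun_sum (u := s)
    fun i hi => (hG i (hs i hi)).1
  constructor
  · simp only [hLU]
    rw [inner_gradient_eq_of_hasFDerivAt
      (((hsum (Finset.range m) fun i hi => by
        have := Finset.mem_range.mp hi; omega).fun_add
        ((hsum (Finset.Ico m N) fun i hi => by
          have := Finset.mem_Ico.mp hi; omega).const_mul (k : ℝ))).const_mul (1 / (Nnew : ℝ)))]
    simp only [smul_apply, add_apply, sum_apply, smul_eq_mul]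
    rw [hfast, hslowsum N hmN hNle, hsub]
    ring
  · simp only [hLG]
    rw [inner_gradient_eq_of_hasFDerivAt
      ((hsum (Finset.range Nnew) fun i hi => Finset.mem_range.mp hi).const_mul (1 / (Nnew : ℝ)))]
    simp only [smul_apply, sum_apply, smul_eq_mul]
    rw [← Finset.sum_range_add_sum_Ico _ (hmN.trans hNle), hfast,
      hslowsum Nnew (hmN.trans hNle) le_rfl, hcard]
    ring
end
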